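/- arXiv:2411.16913 — 2 statements merged into one kernel-verified Lean document; each statement's English description precedes it below -/
import Mathlib

section
/- For every α > 0 with α ≠ 1 and every β with 0 < β < 1, the Sharma–Mittal entropy of the Poisson distribution satisfies lim_{λ→∞} (1-β)·α^{(1-β)/(2(1-α))}·(2πλ)^{(β-1)/2} · H_SM(α,β,λ) = 1; that is, H_SM(α,β,λ) ~ (2πλ)^{(1-β)/2} / ((1-β)·α^{(1-β)/(2(1-α))}) as λ → ∞, and in particular H_SM(α,β,λ) → ∞. -/
open Real Filter Topology

/-- The Poisson probabilities `p_i(λ) = e^{-λ} λ^i / i!`. -/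
noncomputable def poissonP (l : ℝ) (i : ℕ) : ℝ :=
  Real.exp (-l) * l ^ i / (Nat.factorial i)

/-- `ψ(α,λ) = ∑_{i=0}^∞ (p_i(λ))^α`. -/
noncomputable def psiPoisson (α l : ℝ) : ℝ :=
  ∑' i, (poissonP l i) ^ α

open MeasureTheory

/-- The large deviation rate function `t log t - t + 1` of the Poisson distribution. -/
noncomputable def poissonRate (t : ℝ) : ℝ := t * Real.log t - t + 1

lemma sq_sqrt_sub_one_le_poissonRate {t : ℝ} (ht : 0 < t) : (√t - 1) ^ 2 ≤ poissonRate t := by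
  have hs : 0 < √t := Real.sqrt_pos.2 ht
  have h1 := Real.one_sub_inv_le_log_of_pos hs
  rw [Real.log_sqrt ht.le] at h1
  have h2 : t * (1 - (√t)⁻¹) = t - √t := by
    have : t = √t * √t := (Real.mul_self_sqrt ht.le).symm
    rw [mul_sub, mul_one]
    congr 1
    nth_rewrite 1 [this]
    field_simp
  have h3 := mul_le_mul_of_nonneg_left h1 ht.le
  rw [h2] at h3
  have h4 := Real.sq_sqrt ht.le
  unfold poissonRate
  nlinarith

lemma abs_poissonRate_one_add_sub_le {u : ℝ} (hu : |u| ≤ 1 / 2) :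
    |poissonRate (1 + u) - u ^ 2 / 2| ≤ 4 * |u| ^ 3 := by
  have h := Real.abs_log_sub_add_sum_range_le (x := -u) (by rw [abs_neg]; linarith) 2
  simp only [Finset.sum_range_succ, Finset.sum_range_zero, abs_neg] at h
  norm_num at h
  have hu0 := abs_nonneg u
  have h2 : |u| ^ 3 / (1 - |u|) ≤ 2 * |u| ^ 3 := by
    rw [div_le_iff₀ (by linarith)]
    nlinarith [pow_nonneg hu0 3]
  set R := -u + u ^ 2 / 2 + Real.log (1 + u) with hR
  have hR' : |R| ≤ 2 * |u| ^ 3 := h.trans h2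
  have e : poissonRate (1 + u) - u ^ 2 / 2 = -(u ^ 3) / 2 + (1 + u) * R := by
    rw [hR, poissonRate]; ring
  rw [e]
  calc |-(u ^ 3) / 2 + (1 + u) * R| ≤ |-(u ^ 3) / 2| + |(1 + u) * R| := abs_add_le _ _
    _ = |u| ^ 3 / 2 + |1 + u| * |R| := by rw [abs_mul, abs_div, abs_neg, abs_pow]; norm_num
    _ ≤ |u| ^ 3 / 2 + (3 / 2) * (2 * |u| ^ 3) := by
        gcongr
        calc |1 + u| ≤ |1| + |u| := abs_add_le _ _
          _ ≤ 3 / 2 := by rw [abs_one]; linarith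
    _ ≤ 4 * |u| ^ 3 := by nlinarith [pow_nonneg hu0 3]

lemma tendsto_mul_poissonRate {ι : Type*} {F : Filter ι} {l t : ι → ℝ} {x : ℝ}
    (hl : Tendsto l F atTop) (ht : Tendsto (fun i => √(l i) * (t i - 1)) F (𝓝 x)) :
    Tendsto (fun i => l i * poissonRate (t i)) F (𝓝 (x ^ 2 / 2)) := by
  have hs : Tendsto (fun i => √(l i)) F atTop := Real.tendsto_sqrt_atTop.comp hl
  have hu : Tendsto (fun i => t i - 1) F (𝓝 0) := by
    have := (tendsto_inv_atTop_zero.comp hs).mul ht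
    rw [zero_mul] at this
    refine this.congr' ?_
    filter_upwards [hs.eventually_gt_atTop 0] with i hi
    simp only [Function.comp]
    field_simp
  have hb : Tendsto (fun i => 4 * (|t i - 1| * (√(l i) * (t i - 1)) ^ 2)) F (𝓝 0) := by
    have := (hu.abs.mul (ht.pow 2)).const_mul 4
    simpa using this
  have h1 : Tendsto (fun i => l i * poissonRate (t i) - (√(l i) * (t i - 1)) ^ 2 / 2) F (𝓝 0) := by
    refine squeeze_zero_norm' ?_ hb
    have hsm : ∀ᶠ i in F, |t i - 1| ≤ 1 / 2 := by
      have := hu.abs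
      rw [abs_zero] at this
      exact this.eventually_le_const (by norm_num)
    filter_upwards [hsm, hl.eventually_ge_atTop 0] with i hi hli
    have h := abs_poissonRate_one_add_sub_le hi
    rw [add_sub_cancel] at h
    have hq := Real.sq_sqrt hli
    calc ‖l i * poissonRate (t i) - (√(l i) * (t i - 1)) ^ 2 / 2‖
        = ‖l i * (poissonRate (t i) - (t i - 1) ^ 2 / 2)‖ := by
          rw [mul_pow, hq]; ring_nf
      _ = l i * |poissonRate (t i) - (t i - 1) ^ 2 / 2| := by
          rw [norm_mul, Real.norm_of_nonneg hli, Real.norm_eq_abs]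
      _ ≤ l i * (4 * |t i - 1| ^ 3) := by gcongr
      _ = 4 * (|t i - 1| * (√(l i) * (t i - 1)) ^ 2) := by
          rw [mul_pow, hq, ← sq_abs (t i - 1)]; ring
  have := h1.add ((ht.pow 2).div_const 2)
  simpa using this

lemma sqrt_mul_poissonP {l : ℝ} (hl : 0 < l) (n : ℕ) :
    √(2 * π * l) * poissonP l n =
      √((n + 1 : ℕ) / l) * (√π / Stirling.stirlingSeq (n + 1)) *
        Real.exp (-(l * poissonRate ((n + 1 : ℕ) / l))) := by
  have hm : (0 : ℝ) < (n + 1 : ℕ) := by positivity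
  have he : Real.exp (-(l * poissonRate ((n + 1 : ℕ) / l))) =
      Real.exp (-l) * Real.exp 1 ^ (n + 1) * (l ^ (n + 1) / ((n + 1 : ℕ) : ℝ) ^ (n + 1)) := by
    have e1 : -(l * poissonRate ((n + 1 : ℕ) / l)) =
        -l + (n + 1 : ℕ) * 1 + (n + 1 : ℕ) * Real.log (l / (n + 1 : ℕ)) := by
      rw [poissonRate, Real.log_div hl.ne' hm.ne', Real.log_div hm.ne' hl.ne']
      field_simp
      ring
    rw [e1, Real.exp_add, Real.exp_add, Real.exp_nat_mul, Real.exp_nat_mul,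
      Real.exp_log (by positivity), div_pow]
  rw [he, poissonP, Stirling.stirlingSeq, Nat.factorial_succ, div_pow,
    Real.sqrt_mul (by positivity), Real.sqrt_mul (by positivity), Real.sqrt_div hm.le,
    Real.sqrt_mul (by positivity)]
  have h1 := Real.sq_sqrt hl.le
  have h2 := Real.sq_sqrt hm.le
  have hs : 0 < √l := Real.sqrt_pos.2 hl
  have hs2 : 0 < √((n + 1 : ℕ) : ℝ) := Real.sqrt_pos.2 hm
  set a := √l
  set b := √((n + 1 : ℕ) : ℝ)
  set m : ℝ := ((n + 1 : ℕ) : ℝ)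
  rw [Nat.cast_mul]
  field_simp
  rw [h1, h2]
  ring

lemma poissonP_nonneg {l : ℝ} (hl : 0 ≤ l) (n : ℕ) : 0 ≤ poissonP l n := by
  unfold poissonP; positivity

lemma sqrt_mul_poissonP_floor_le {l x : ℝ} (hl : 1 ≤ l) (hx : 0 ≤ l + √l * x) :
    √(2 * π * l) * poissonP l ⌊l + √l * x⌋₊ ≤ 2 * Real.exp (1 / 2 - |x| / 4) := by
  have hl0 : 0 < l := by linarith
  rw [sqrt_mul_poissonP hl0]
  have hlo := Nat.lt_floor_add_one (l + √l * x)
  have hhi := Nat.floor_le hx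
  set n := ⌊l + √l * x⌋₊
  have hm : (0 : ℝ) < (n + 1 : ℕ) := by positivity
  have hmn : ((n + 1 : ℕ) : ℝ) = n + 1 := by push_cast; ring
  have hrate := sq_sqrt_sub_one_le_poissonRate (div_pos hm hl0)
  have hst : √π / Stirling.stirlingSeq (n + 1) ≤ 1 :=
    div_le_one_of_le₀ (Stirling.sqrt_pi_le_stirlingSeq (by simp)) (Stirling.stirlingSeq'_pos n).le
  have ha : 1 ≤ √l := Real.one_le_sqrt.2 hl
  have hl2 := Real.sq_sqrt hl0.le
  obtain ⟨y, hy⟩ : ∃ y, y = √l * (√((n + 1 : ℕ) / l) - 1) := ⟨_, rfl⟩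
  have ht : √((n + 1 : ℕ) / l) = 1 + y / √l := by rw [hy]; field_simp; ring
  have hy2 : y ^ 2 ≤ l * poissonRate ((n + 1 : ℕ) / l) := by
    rw [hy, mul_pow, hl2]; gcongr
  have hml : (n + 1 : ℝ) - l = y ^ 2 + 2 * y * √l := by
    have h1 : ((n + 1 : ℕ) : ℝ) = (√l * √((n + 1 : ℕ) / l)) ^ 2 := by
      rw [mul_pow, hl2, Real.sq_sqrt (by positivity)]; field_simp
    have h2 : √l * √((n + 1 : ℕ) / l) = √l + y := by rw [hy]; ring
    rw [← hmn, h1, h2]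
    linear_combination hl2
  have hxy : |x| ≤ 2 * y ^ 2 + 2 := by
    have h1 : √l * |x| ≤ √l * (y ^ 2 + 2 * |y| + 1) := by
      rw [← abs_of_pos (by linarith : 0 < √l), ← abs_mul, abs_of_pos (by linarith : 0 < √l)]
      have := mul_le_mul_of_nonneg_right (le_abs_self y) (by linarith : 0 ≤ √l)
      have := mul_le_mul_of_nonneg_right (neg_abs_le y) (by linarith : 0 ≤ √l)
      have := mul_le_mul_of_nonneg_right ha (sq_nonneg y)
      rw [abs_le]
      constructor <;> nlinarith [sq_nonneg y]
    have h2 := le_of_mul_le_mul_left h1 (by linarith)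
    nlinarith [sq_nonneg (|y| - 1), sq_abs y]
  have hty : √((n + 1 : ℕ) / l) ≤ 2 * Real.exp (y ^ 2 / 2) := by
    have h1 : y / √l ≤ |y| := (div_le_div_of_nonneg_right (le_abs_self y) (by linarith)).trans
      (div_le_self (abs_nonneg y) ha)
    have h2 := Real.add_one_le_exp (y ^ 2 / 2)
    rw [ht]
    nlinarith [sq_nonneg (|y| - 1), sq_abs y]
  calc √((n + 1 : ℕ) / l) * (√π / Stirling.stirlingSeq (n + 1)) *
        Real.exp (-(l * poissonRate ((n + 1 : ℕ) / l)))
      ≤ 2 * Real.exp (y ^ 2 / 2) * 1 * Real.exp (-y ^ 2) := by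
        gcongr
        exact div_nonneg (Real.sqrt_nonneg _) (Stirling.stirlingSeq'_pos n).le
    _ = 2 * Real.exp (-(y ^ 2 / 2)) := by
        rw [mul_one, mul_assoc, ← Real.exp_add]; ring_nf
    _ ≤ 2 * Real.exp (1 / 2 - |x| / 4) := by
        gcongr; linarith

lemma tendsto_add_sqrt_mul_atTop (x : ℝ) : Tendsto (fun l : ℝ => l + √l * x) atTop atTop := by
  have h : Tendsto (fun l : ℝ => √l * (√l + x)) atTop atTop :=
    Real.tendsto_sqrt_atTop.atTop_mul_atTop₀
      (tendsto_atTop_add_const_right _ x Real.tendsto_sqrt_atTop)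
  refine h.congr' ?_
  filter_upwards [eventually_ge_atTop 0] with l hl
  rw [mul_add, Real.mul_self_sqrt hl]

/-- The local limit theorem for the Poisson distribution. -/
lemma tendsto_sqrt_mul_poissonP_floor (x : ℝ) :
    Tendsto (fun l : ℝ => √(2 * π * l) * poissonP l ⌊l + √l * x⌋₊) atTop
      (𝓝 (Real.exp (-(x ^ 2 / 2)))) := by
  have hfl : Tendsto (fun l : ℝ => ⌊l + √l * x⌋₊ + 1) atTop atTop :=
    (tendsto_add_atTop_nat 1).comp
      (tendsto_nat_floor_atTop.comp (tendsto_add_sqrt_mul_atTop x))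
  have hinv : Tendsto (fun l : ℝ => (√l)⁻¹) atTop (𝓝 0) :=
    tendsto_inv_atTop_zero.comp Real.tendsto_sqrt_atTop
  have hdev : Tendsto (fun l : ℝ => √l * (((⌊l + √l * x⌋₊ + 1 : ℕ) : ℝ) / l - 1)) atTop (𝓝 x) := by
    have hup : Tendsto (fun l : ℝ => x + (√l)⁻¹) atTop (𝓝 x) := by
      simpa using hinv.const_add x
    have key : ∀ᶠ l : ℝ in atTop, x ≤ √l * (((⌊l + √l * x⌋₊ + 1 : ℕ) : ℝ) / l - 1) ∧
        √l * (((⌊l + √l * x⌋₊ + 1 : ℕ) : ℝ) / l - 1) ≤ x + (√l)⁻¹ := by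
      filter_upwards [eventually_gt_atTop 0, (tendsto_add_sqrt_mul_atTop x).eventually_ge_atTop 0]
        with l hl hx
      have hlo := Nat.lt_floor_add_one (l + √l * x)
      have hhi := Nat.floor_le hx
      have hs : 0 < √l := Real.sqrt_pos.2 hl
      have e : √l * (((⌊l + √l * x⌋₊ + 1 : ℕ) : ℝ) / l - 1) =
          ((⌊l + √l * x⌋₊ + 1 : ℝ) - l) / √l := by
        have := Real.sq_sqrt hl.le
        push_cast
        field_simp
        rw [this]
      rw [e, le_div_iff₀ hs, div_le_iff₀ hs, add_mul, inv_mul_cancel₀ hs.ne']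
      constructor <;> linarith
    exact tendsto_of_tendsto_of_tendsto_of_le_of_le' tendsto_const_nhds hup
      (key.mono fun _ h => h.1) (key.mono fun _ h => h.2)
  have ht : Tendsto (fun l : ℝ => ((⌊l + √l * x⌋₊ + 1 : ℕ) : ℝ) / l) atTop (𝓝 1) := by
    have := (hinv.mul hdev).add_const 1
    rw [zero_mul, zero_add] at this
    refine this.congr' ?_
    filter_upwards [eventually_gt_atTop 0] with l hl
    have hs : 0 < √l := Real.sqrt_pos.2 hl
    field_simp
    ring
  have hst : Tendsto (fun l : ℝ => √π / Stirling.stirlingSeq (⌊l + √l * x⌋₊ + 1)) atTop (𝓝 1) := by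
    have hpi : √π ≠ 0 := (Real.sqrt_pos.2 Real.pi_pos).ne'
    have := (tendsto_const_nhds (x := √π)).div (Stirling.tendsto_stirlingSeq_sqrt_pi.comp hfl) hpi
    rwa [div_self hpi] at this
  have hexp := (tendsto_mul_poissonRate tendsto_id hdev).neg.rexp
  have := ((ht.sqrt).mul hst).mul hexp
  rw [Real.sqrt_one, one_mul, one_mul] at this
  refine this.congr' ?_
  filter_upwards [eventually_gt_atTop 0] with l hl
  rw [sqrt_mul_poissonP hl]
  rfl

lemma integral_indicator_comp_floor {f : ℕ → ℝ} (hf : ∀ n, 0 ≤ f n) :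
    ∫ s : ℝ, (Set.Ici (0 : ℝ)).indicator (fun s => f ⌊s⌋₊) s = ∑' n, f n := by
  have hmeas : Measurable (fun s : ℝ => f ⌊s⌋₊) :=
    (measurable_from_top (f := f)).comp Nat.measurable_floor
  have hU : (Set.Ici (0 : ℝ)) = ⋃ n : ℕ, Set.Ico (n : ℝ) (n + 1) := by
    ext s
    simp only [Set.mem_Ici, Set.mem_iUnion, Set.mem_Ico]
    constructor
    · intro hs
      exact ⟨⌊s⌋₊, Nat.floor_le hs, Nat.lt_floor_add_one s⟩
    · rintro ⟨n, hn, -⟩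
      exact (Nat.cast_nonneg n).trans hn
  rw [integral_indicator measurableSet_Ici, integral_eq_lintegral_of_nonneg_ae
    (Eventually.of_forall fun s => hf _) hmeas.aestronglyMeasurable, hU, lintegral_iUnion
    (fun _ => measurableSet_Ico)]
  · have : ∀ n : ℕ, ∫⁻ s in Set.Ico (n : ℝ) (n + 1), ENNReal.ofReal (f ⌊s⌋₊) =
        ENNReal.ofReal (f n) := by
      intro n
      rw [setLIntegral_congr_fun (g := fun _ => ENNReal.ofReal (f n)) measurableSet_Ico]
      · simp
      · intro s hs
        simp only
        rw [(Nat.floor_eq_iff ((Nat.cast_nonneg n).trans hs.1)).2 hs]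
    simp_rw [this]
    rw [ENNReal.tsum_toReal_eq fun _ => ENNReal.ofReal_ne_top]
    exact tsum_congr fun n => ENNReal.toReal_ofReal (hf n)
  · intro i j hij
    refine Set.disjoint_left.2 fun s hi hj => hij ?_
    rw [← (Nat.floor_eq_iff ((Nat.cast_nonneg i).trans hi.1)).2 hi,
      ← (Nat.floor_eq_iff ((Nat.cast_nonneg j).trans hj.1)).2 hj]

lemma integrable_exp_neg_mul_abs {c : ℝ} (hc : 0 < c) :
    Integrable (fun x : ℝ => Real.exp (-c * |x|)) := by
  rw [← integrableOn_univ, ← Set.Iic_union_Ioi (a := (0 : ℝ))]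
  refine IntegrableOn.union ?_ ?_
  · refine (integrableOn_exp_mul_Iic hc 0).congr_fun (fun x hx => ?_) measurableSet_Iic
    simp only
    rw [abs_of_nonpos hx]; ring_nf
  · refine (integrableOn_exp_mul_Ioi (neg_lt_zero.2 hc) 0).congr_fun (fun x hx => ?_)
      measurableSet_Ioi
    simp only
    rw [abs_of_pos hx]

lemma tendsto_rpow_mul_psiPoisson {α : ℝ} (hα : 0 < α) :
    Tendsto (fun l : ℝ => (2 * π * l) ^ ((α - 1) / 2) * psiPoisson α l) atTop
      (𝓝 (α ^ (-(1 / 2) : ℝ))) := by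
  set F : ℝ → ℝ → ℝ := fun l =>
    (Set.Ici (0 : ℝ)).indicator (fun s => (√(2 * π * l) * poissonP l ⌊s⌋₊) ^ α) with hF
  have hlim : Tendsto (fun l : ℝ => ∫ x, F l (l + √l * x)) atTop
      (𝓝 (∫ x, Real.exp (-(α / 2) * x ^ 2))) := by
    refine tendsto_integral_filter_of_dominated_convergence
      (fun x => (2 * Real.exp (1 / 2)) ^ α * Real.exp (-(α / 4) * |x|)) ?_ ?_ ?_ ?_
    · refine Eventually.of_forall fun l => Measurable.aestronglyMeasurable ?_
      have h : Measurable (F l) := Measurable.indicator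
        ((measurable_from_top (f := fun n : ℕ => (√(2 * π * l) * poissonP l n) ^ α)).comp
          Nat.measurable_floor) measurableSet_Ici
      exact h.comp (by fun_prop)
    · filter_upwards [eventually_ge_atTop 1] with l hl
      refine Eventually.of_forall fun x => ?_
      by_cases hx : 0 ≤ l + √l * x
      · have h0 : 0 ≤ √(2 * π * l) * poissonP l ⌊l + √l * x⌋₊ :=
          mul_nonneg (Real.sqrt_nonneg _) (poissonP_nonneg (by linarith) _)
        rw [hF]
        simp only
        rw [Set.indicator_of_mem (Set.mem_Ici.2 hx), Real.norm_of_nonneg (by positivity)]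
        refine (Real.rpow_le_rpow h0 (sqrt_mul_poissonP_floor_le hl hx) hα.le).trans_eq ?_
        rw [sub_eq_add_neg, Real.exp_add, ← mul_assoc, Real.mul_rpow (by positivity) (by positivity),
          ← Real.exp_mul (-(|x| / 4))]
        ring_nf
      · rw [hF]
        simp only
        rw [Set.indicator_of_notMem (by simpa using hx), norm_zero]
        positivity
    · exact (integrable_exp_neg_mul_abs (by positivity)).const_mul _
    · refine Eventually.of_forall fun x => ?_
      have := (tendsto_sqrt_mul_poissonP_floor x).rpow_const (p := α) (Or.inr hα.le)
      rw [← Real.exp_mul, show -(x ^ 2 / 2) * α = -(α / 2) * x ^ 2 by ring] at this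
      refine this.congr' ?_
      filter_upwards [(tendsto_add_sqrt_mul_atTop x).eventually_ge_atTop 0] with l hl
      rw [hF]
      simp only
      rw [Set.indicator_of_mem (Set.mem_Ici.2 hl)]
  rw [integral_gaussian] at hlim
  have h2 := hlim.const_mul (√(2 * π))⁻¹
  have hpi := Real.pi_pos
  have e : (√(2 * π))⁻¹ * √(π / (α / 2)) = α ^ (-(1 / 2) : ℝ) := by
    rw [← Real.sqrt_inv, ← Real.sqrt_mul (by positivity), Real.rpow_neg hα.le,
      ← Real.sqrt_eq_rpow, ← Real.sqrt_inv]
    congr 1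
    field_simp
  rw [e] at h2
  refine h2.congr' ?_
  filter_upwards [eventually_gt_atTop 0] with l hl
  have hs : 0 < √l := Real.sqrt_pos.2 hl
  have hint : ∫ x, F l (l + √l * x) = (√l)⁻¹ * ((√(2 * π * l)) ^ α * psiPoisson α l) := by
    rw [Measure.integral_comp_mul_left (fun s => F l (l + s)),
      integral_add_left_eq_self (F l) l, hF]
    simp only
    rw [integral_indicator_comp_floor (f := fun n => (√(2 * π * l) * poissonP l n) ^ α)
      fun n => Real.rpow_nonneg (mul_nonneg (Real.sqrt_nonneg _) (poissonP_nonneg hl.le _)) _,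
      abs_of_pos (inv_pos.2 hs), smul_eq_mul, psiPoisson,
      ← tsum_mul_left (a := √(2 * π * l) ^ α)]
    congr 1
    exact tsum_congr fun n => Real.mul_rpow (Real.sqrt_nonneg _) (poissonP_nonneg hl.le _)
  rw [hint, ← mul_assoc, ← mul_inv, ← Real.sqrt_mul (by positivity), ← mul_assoc]
  congr 1
  have hp : 0 < 2 * π * l := by positivity
  rw [Real.sqrt_eq_rpow, ← Real.rpow_mul hp.le, ← Real.rpow_neg hp.le, ← Real.rpow_add hp]
  congr 1
  ring

/-- asymptotics of the Sharma–Mittal entropy of the Poisson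
distribution for 0 < β < 1. -/
theorem sharmaMittal_poisson_asymptotic (α β : ℝ) (hα : 0 < α) (hα1 : α ≠ 1)
    (hβ : 0 < β) (hβ1 : β < 1) :
    Tendsto (fun l : ℝ => (1 - β) * α ^ ((1 - β) / (2 * (1 - α))) *
        (2 * Real.pi * l) ^ ((β - 1) / 2) *
        ((1 - β)⁻¹ * ((psiPoisson α l) ^ ((1 - β) / (1 - α)) - 1)))
      atTop (𝓝 1) ∧
    Tendsto (fun l : ℝ => (1 - β)⁻¹ * ((psiPoisson α l) ^ ((1 - β) / (1 - α)) - 1))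
      atTop atTop := by
  have hα1' : 1 - α ≠ 0 := sub_ne_zero.2 hα1.symm
  have hβ' : 0 < 1 - β := sub_pos.2 hβ1
  have hlin : Tendsto (fun l : ℝ => 2 * π * l) atTop atTop :=
    tendsto_id.const_mul_atTop (by positivity)
  have hpow : Tendsto (fun l : ℝ => (2 * π * l) ^ ((β - 1) / 2)) atTop (𝓝 0) := by
    rw [show (β - 1) / 2 = -((1 - β) / 2) by ring]
    exact (tendsto_rpow_neg_atTop (by positivity)).comp hlin
  have hψ := (tendsto_rpow_mul_psiPoisson hα).rpow_const (p := (1 - β) / (1 - α))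
    (Or.inl (Real.rpow_pos_of_pos hα _).ne')
  set c := α ^ ((1 - β) / (2 * (1 - α))) with hc
  have hc0 : 0 < c := Real.rpow_pos_of_pos hα _
  have hcψ : c * (α ^ (-(1 / 2) : ℝ)) ^ ((1 - β) / (1 - α)) = 1 := by
    have h0 : (1 - β) / (2 * (1 - α)) + -(1 / 2) * ((1 - β) / (1 - α)) = 0 := by
      field_simp
      ring
    rw [← Real.rpow_mul hα.le, hc, ← Real.rpow_add hα, h0, Real.rpow_zero]
  have hfirst : Tendsto (fun l : ℝ => (1 - β) * c * (2 * Real.pi * l) ^ ((β - 1) / 2) *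
      ((1 - β)⁻¹ * ((psiPoisson α l) ^ ((1 - β) / (1 - α)) - 1))) atTop (𝓝 1) := by
    have h := (hψ.const_mul c).sub (hpow.const_mul c)
    rw [hcψ, mul_zero, sub_zero] at h
    refine h.congr' ?_
    filter_upwards [eventually_gt_atTop 0] with l hl
    have hp : 0 < 2 * π * l := by positivity
    have hψ0 : 0 ≤ psiPoisson α l :=
      tsum_nonneg fun n => Real.rpow_nonneg (poissonP_nonneg hl.le n) _
    have hexp : (α - 1) / 2 * ((1 - β) / (1 - α)) = (β - 1) / 2 := by
      field_simp
      ring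
    rw [Real.mul_rpow (Real.rpow_nonneg hp.le _) hψ0, ← Real.rpow_mul hp.le, hexp]
    field_simp
  refine ⟨hfirst, ?_⟩
  have hgrow : Tendsto (fun l : ℝ => ((1 - β) * c)⁻¹ * (2 * π * l) ^ ((1 - β) / 2)) atTop atTop :=
    ((tendsto_rpow_atTop (by positivity)).comp hlin).const_mul_atTop (by positivity)
  refine (hgrow.atTop_mul_pos one_pos hfirst).congr' ?_
  filter_upwards [eventually_gt_atTop 0] with l hl
  have hp : 0 < 2 * π * l := by positivity
  have hcancel : (2 * π * l) ^ ((1 - β) / 2) * (2 * π * l) ^ ((β - 1) / 2) = 1 := by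
    rw [← Real.rpow_add hp, show (1 - β) / 2 + (β - 1) / 2 = 0 by ring, Real.rpow_zero]
  calc _ = (((1 - β) * c)⁻¹ * ((1 - β) * c)) *
        ((2 * π * l) ^ ((1 - β) / 2) * (2 * π * l) ^ ((β - 1) / 2)) *
        ((1 - β)⁻¹ * ((psiPoisson α l) ^ ((1 - β) / (1 - α)) - 1)) := by ring
    _ = _ := by rw [hcancel, inv_mul_cancel₀ (by positivity), one_mul, one_mul]
end

section
/- For all α, β > 0 with α ≠ 1 and β ≠ 1, the Sharma–Mittal entropy of the Poisson distribution, λ ↦ H_SM(α,β,λ), is strictly increasing on (0,∞). -/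
open Real Filter Topology

theorem ConvexOn.map_sum_le_of_sum_le_one {ι : Type*} {t : Finset ι} {f : ℝ → ℝ} {s : Set ℝ}
    {w p : ι → ℝ} (hf : ConvexOn ℝ s f) (hs : (0 : ℝ) ∈ s) (hf0 : f 0 = 0)
    (hw : ∀ i ∈ t, 0 ≤ w i) (hw1 : ∑ i ∈ t, w i ≤ 1) (hp : ∀ i ∈ t, p i ∈ s) :
    f (∑ i ∈ t, w i * p i) ≤ ∑ i ∈ t, w i * f (p i) := by
  have h := hf.map_add_sum_le (v := 1 - ∑ i ∈ t, w i) (q := 0) hw (by ring) hp (by linarith) hs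
  simpa [hf0] using h

theorem poissonP_pos {l : ℝ} (hl : 0 < l) (i : ℕ) : 0 < poissonP l i := by
  unfold poissonP
  positivity

theorem hasSum_poissonP (l : ℝ) : HasSum (poissonP l) 1 := by
  have h := (NormedSpace.expSeries_div_hasSum_exp l).mul_left (Real.exp (-l))
  rw [← Real.exp_eq_exp_ℝ, ← Real.exp_add, neg_add_cancel, Real.exp_zero] at h
  simpa only [← mul_div_assoc] using! h

theorem summable_poissonP_rpow {α l : ℝ} (hα : 0 < α) (hl : 0 < l) :
    Summable fun i => poissonP l i ^ α := by
  refine summable_of_ratio_test_tendsto_lt_one zero_lt_one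
    (Eventually.of_forall fun i => (rpow_pos_of_pos (poissonP_pos hl i) α).ne') ?_
  have hratio (i : ℕ) :
      ‖poissonP l (i + 1) ^ α‖ / ‖poissonP l i ^ α‖ = (l / ((i + 1 : ℕ) : ℝ)) ^ α := by
    have hi := poissonP_pos hl i
    have hi' := poissonP_pos hl (i + 1)
    rw [Real.norm_of_nonneg (rpow_nonneg hi.le α), Real.norm_of_nonneg (rpow_nonneg hi'.le α),
      ← div_rpow hi'.le hi.le]
    congr 1
    simp only [poissonP, Nat.factorial_succ, pow_succ, Nat.cast_mul]
    field_simp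
  simp only [hratio]
  have h := ((tendsto_const_div_atTop_nhds_zero_nat l).comp (tendsto_add_atTop_nat 1)).rpow_const
    (p := α) (Or.inr hα.le)
  simpa [zero_rpow hα.ne', Function.comp_def] using h

theorem poissonP_add (a b : ℝ) (n : ℕ) :
    poissonP (a + b) n =
      ∑ kl ∈ Finset.HasAntidiagonal.antidiagonal n, poissonP a kl.1 * poissonP b kl.2 := by
  simp only [poissonP]
  rw [(Commute.all a b).add_pow', Finset.mul_sum, Finset.sum_div]
  refine Finset.sum_congr rfl fun kl hkl => ?_
  obtain rfl := Finset.HasAntidiagonal.mem_antidiagonal.mp hkl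
  have hfac : (((kl.1 + kl.2).choose kl.1 : ℕ) : ℝ) * kl.1.factorial * kl.2.factorial =
      (kl.1 + kl.2).factorial := by
    rw [Nat.choose_symm_add]
    exact_mod_cast Nat.add_choose_mul_factorial_mul_factorial kl.1 kl.2
  rw [nsmul_eq_mul, ← hfac, neg_add, Real.exp_add]
  have hne : (((kl.1 + kl.2).choose kl.1 : ℕ) : ℝ) ≠ 0 := by
    exact_mod_cast (Nat.choose_pos (Nat.le_add_right _ _)).ne'
  field_simp

/-- Jensen's inequality for the convolution `poissonP (a + b) = poissonP a * poissonP b`. -/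
theorem tsum_map_poissonP_add_lt {f : ℝ → ℝ} (hf : ConvexOn ℝ (Set.Ici 0) f) (hf0 : f 0 = 0)
    {a b : ℝ} (ha : 0 < a) (hb : 0 < b) (hsb : Summable fun i => f (poissonP b i))
    (hsab : Summable fun i => f (poissonP (a + b) i))
    (hlt : f (poissonP a 0 * poissonP b 0) < poissonP a 0 * f (poissonP b 0)) :
    ∑' i, f (poissonP (a + b) i) < ∑' i, f (poissonP b i) := by
  have hsa := (hasSum_poissonP a).summable
  have hcauchy := tsum_mul_tsum_eq_tsum_sum_antidiagonal_of_summable_norm hsa.norm hsb.norm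
  rw [(hasSum_poissonP a).tsum_eq, one_mul] at hcauchy
  rw [hcauchy]
  refine Summable.tsum_lt_tsum (i := 0) (fun n => ?_) ?_ hsab
    (summable_norm_sum_mul_antidiagonal_of_summable_norm hsa.norm hsb.norm).of_norm
  · rw [poissonP_add]
    refine hf.map_sum_le_of_sum_le_one Set.self_mem_Ici hf0
      (fun kl _ => (poissonP_pos ha kl.1).le) ?_ fun kl _ => (poissonP_pos hb kl.2).le
    rw [Finset.Nat.sum_antidiagonal_eq_sum_range_succ fun k _ => poissonP a k]
    exact sum_le_hasSum _ (fun i _ => (poissonP_pos ha i).le) (hasSum_poissonP a)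
  · simpa [poissonP_add] using hlt

theorem poissonP_zero_lt_one {l : ℝ} (hl : 0 < l) : poissonP l 0 < 1 := by
  simpa [poissonP] using hl

theorem psiPoisson_pos {α l : ℝ} (hα : 0 < α) (hl : 0 < l) : 0 < psiPoisson α l :=
  (summable_poissonP_rpow hα hl).tsum_pos
    (fun i => (rpow_pos_of_pos (poissonP_pos hl i) α).le) 0 (rpow_pos_of_pos (poissonP_pos hl 0) α)

theorem psiPoisson_strictAntiOn {α : ℝ} (hα : 1 < α) :
    StrictAntiOn (psiPoisson α) (Set.Ioi 0) := by
  intro b hb c _ hbc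
  rw [Set.mem_Ioi] at hb
  have hα0 : 0 < α := by linarith
  obtain ⟨a, ha, rfl⟩ : ∃ a, 0 < a ∧ c = a + b := ⟨c - b, by linarith, by ring⟩
  refine tsum_map_poissonP_add_lt (convexOn_rpow hα.le) (zero_rpow hα0.ne') ha hb
    (summable_poissonP_rpow hα0 hb) (summable_poissonP_rpow hα0 (by linarith)) ?_
  rw [mul_rpow (poissonP_pos ha 0).le (poissonP_pos hb 0).le]
  exact mul_lt_mul_of_pos_right
    (rpow_lt_self_of_lt_one (poissonP_pos ha 0) (poissonP_zero_lt_one ha) hα)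
    (rpow_pos_of_pos (poissonP_pos hb 0) α)

theorem psiPoisson_strictMonoOn {α : ℝ} (hα0 : 0 < α) (hα : α < 1) :
    StrictMonoOn (psiPoisson α) (Set.Ioi 0) := by
  intro b hb c _ hbc
  rw [Set.mem_Ioi] at hb
  obtain ⟨a, ha, rfl⟩ : ∃ a, 0 < a ∧ c = a + b := ⟨c - b, by linarith, by ring⟩
  have h := tsum_map_poissonP_add_lt (f := fun x => -x ^ α)
    (Real.concaveOn_rpow hα0.le hα.le).neg (by simp [zero_rpow hα0.ne']) ha hb
    (summable_poissonP_rpow hα0 hb).neg (summable_poissonP_rpow hα0 (by linarith)).neg ?_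
  · rw [tsum_neg, tsum_neg] at h
    exact neg_lt_neg_iff.mp h
  · rw [mul_rpow (poissonP_pos ha 0).le (poissonP_pos hb 0).le, mul_neg, neg_lt_neg_iff]
    exact mul_lt_mul_of_pos_right
      (self_lt_rpow_of_lt_one (poissonP_pos ha 0) (poissonP_zero_lt_one ha) hα)
      (rpow_pos_of_pos (poissonP_pos hb 0) α)

/-- the Sharma–Mittal entropy of the Poisson distribution is
strictly increasing in λ. -/
theorem sharmaMittal_poisson_strictMono (α β : ℝ) (hα : 0 < α) (hα1 : α ≠ 1)
    (hβ : 0 < β) (hβ1 : β ≠ 1) :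
    StrictMonoOn
      (fun l : ℝ => (1 - β)⁻¹ * ((psiPoisson α l) ^ ((1 - β) / (1 - α)) - 1))
      (Set.Ioi (0 : ℝ)) := by
  intro b hb c hc hbc
  have hψb := psiPoisson_pos hα hb
  have hψc := psiPoisson_pos hα hc
  rcases hα1.lt_or_gt with hα1 | hα1 <;> rcases hβ1.lt_or_gt with hβ1 | hβ1
  · have hexp : 0 < (1 - β) / (1 - α) := div_pos (by linarith) (by linarith)
    exact mul_lt_mul_of_pos_left (sub_lt_sub_right
      (rpow_lt_rpow hψb.le (psiPoisson_strictMonoOn hα hα1 hb hc hbc) hexp) 1)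
      (inv_pos.mpr (by linarith))
  · have hexp : (1 - β) / (1 - α) < 0 := div_neg_of_neg_of_pos (by linarith) (by linarith)
    exact mul_lt_mul_of_neg_left (sub_lt_sub_right
      (rpow_lt_rpow_of_neg hψb (psiPoisson_strictMonoOn hα hα1 hb hc hbc) hexp) 1)
      (inv_lt_zero.mpr (by linarith))
  · have hexp : (1 - β) / (1 - α) < 0 := div_neg_of_pos_of_neg (by linarith) (by linarith)
    exact mul_lt_mul_of_pos_left (sub_lt_sub_right
      (rpow_lt_rpow_of_neg hψc (psiPoisson_strictAntiOn hα1 hb hc hbc) hexp) 1)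
      (inv_pos.mpr (by linarith))
  · have hexp : 0 < (1 - β) / (1 - α) := div_pos_of_neg_of_neg (by linarith) (by linarith)
    exact mul_lt_mul_of_neg_left (sub_lt_sub_right
      (rpow_lt_rpow hψc.le (psiPoisson_strictAntiOn hα1 hb hc hbc) hexp) 1)
      (inv_lt_zero.mpr (by linarith))
end
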